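/- Let ε ∈ (0,1) and let K be the number of distinct explanations, K = |{e(x) : x ∈ X}|. If the sample size satisfies n ≥ K · (12/ε) · log(3/ε), then the mean-squared error of the faithfulness estimator is at most ε: E[(M̂ − m)²] ≤ ε. -/

import Mathlib

open Classical

lemma aux_split {X : Type*} [Fintype X] {k : ℕ} (i : Fin (k+1)) (F : (Fin (k+1) → X) → ℝ) :
    ∑ xs, F xs = ∑ x, ∑ ys : Fin k → X, F (i.insertNth x ys) := by
  rw [← (Fin.insertNthEquiv (fun _ => X) i).sum_comp, Fintype.sum_prod_type]
  rfl

lemma aux_card {X : Type*} {k : ℕ} (i : Fin (k+1)) (A : X → Prop) (x : X)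
    (ys : Fin k → X) :
    (Finset.univ.filter (fun j => A ((i.insertNth x ys : Fin (k+1) → X) j))).card
      = (if A x then 1 else 0) + (Finset.univ.filter (fun j => A (ys j))).card := by
  rw [Finset.card_filter, Fin.sum_univ_succAbove _ i, Finset.card_filter]
  simp

lemma aux_prod {X : Type*} (μ : X → ℝ) {k : ℕ} (i : Fin (k+1)) (x : X)
    (ys : Fin k → X) :
    ∏ j, μ ((i.insertNth x ys : Fin (k+1) → X) j) = μ x * ∏ j, μ (ys j) := by
  rw [Fin.prod_univ_succAbove _ i]; simp

lemma aux_sum {X : Type*} (μ : X → ℝ) {k : ℕ} (i : Fin (k+1)) (x : X)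
    (ys : Fin k → X) :
    ∑ j, μ ((i.insertNth x ys : Fin (k+1) → X) j) = μ x + ∑ j, μ (ys j) := by
  rw [Fin.sum_univ_succAbove _ i]; simp

lemma aux_first {X : Type*} [Fintype X] (μ : X → ℝ) (A : X → Prop) (ξ : X → ℝ)
    (hξ : ∀ x, ¬ A x → ξ x = 0) (h1 : ∑ x, μ x * ξ x = 0) (k : ℕ) :
    ∀ h : ℕ → ℝ, ∑ ys : Fin k → X, (∏ j, μ (ys j)) *
      (h (Finset.univ.filter (fun j => A (ys j))).card * ∑ j, ξ (ys j)) = 0 := by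
  induction k with
  | zero => intro h; simp
  | succ k ih =>
    intro h
    rw [aux_split 0]
    simp only [aux_card, aux_prod, aux_sum]
    have : ∀ x : X, ∑ ys : Fin k → X, (μ x * ∏ j, μ (ys j)) *
        (h ((if A x then 1 else 0) + (Finset.univ.filter (fun j => A (ys j))).card)
          * (ξ x + ∑ j, ξ (ys j)))
        = (μ x * ξ x) * ∑ ys : Fin k → X, (∏ j, μ (ys j)) *
          h (1 + (Finset.univ.filter (fun j => A (ys j))).card) := by
      intro x
      have e1 := ih (fun a => h ((if A x then 1 else 0) + a))
      have e2 : μ x * ∑ ys : Fin k → X, (∏ j, μ (ys j)) *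
        (h ((if A x then 1 else 0) + (Finset.univ.filter (fun j => A (ys j))).card)
          * (∑ j, ξ (ys j))) = 0 := by rw [e1, mul_zero]
      rw [← sub_eq_zero, ← e2]
      simp only [Finset.mul_sum (a := μ x), Finset.mul_sum (a := μ x * ξ x)]
      rw [← Finset.sum_sub_distrib]
      apply Finset.sum_congr rfl
      intro ys _
      by_cases hA : A x
      · simp only [hA, if_true]; ring
      · simp only [hA, if_false, hξ x hA]; ring
    simp only [this]
    rw [← Finset.sum_mul, h1, zero_mul]

lemma aux_second {X : Type*} [Fintype X] (μ : X → ℝ) (A : X → Prop) (ξ : X → ℝ) (v : ℝ)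
    (hξ : ∀ x, ¬ A x → ξ x = 0) (h1 : ∑ x, μ x * ξ x = 0)
    (h2 : ∑ x, μ x * ξ x ^ 2 = v * ∑ x, μ x * (if A x then 1 else 0)) (k : ℕ) :
    ∀ h : ℕ → ℝ, ∑ ys : Fin k → X, (∏ j, μ (ys j)) *
      (h (Finset.univ.filter (fun j => A (ys j))).card * (∑ j, ξ (ys j)) ^ 2) =
      v * ∑ ys : Fin k → X, (∏ j, μ (ys j)) *
      (h (Finset.univ.filter (fun j => A (ys j))).card *
        ((Finset.univ.filter (fun j => A (ys j))).card : ℝ)) := by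
  induction k with
  | zero => intro h; simp
  | succ k ih =>
    intro h
    rw [aux_split 0, aux_split 0]
    simp only [aux_card, aux_prod, aux_sum]
    set T := ∑ ys : Fin k → X, (∏ j, μ (ys j)) *
          h (1 + (Finset.univ.filter (fun j => A (ys j))).card) with hT
    have L : ∀ x : X, ∑ ys : Fin k → X, (μ x * ∏ j, μ (ys j)) *
        (h ((if A x then 1 else 0) + (Finset.univ.filter (fun j => A (ys j))).card)
          * (ξ x + ∑ j, ξ (ys j)) ^ 2)
        = (μ x * ξ x ^ 2) * T + μ x * (v * ∑ ys : Fin k → X, (∏ j, μ (ys j)) *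
          (h ((if A x then 1 else 0) + (Finset.univ.filter (fun j => A (ys j))).card) *
        ((Finset.univ.filter (fun j => A (ys j))).card : ℝ))) := by
      intro x
      have e1 := ih (fun a => h ((if A x then 1 else 0) + a))
      have e3 := aux_first μ A ξ hξ h1 k (fun a => h ((if A x then 1 else 0) + a))
      have e2 : 2 * μ x * ξ x * ∑ ys : Fin k → X, (∏ j, μ (ys j)) *
        (h ((if A x then 1 else 0) + (Finset.univ.filter (fun j => A (ys j))).card)
          * (∑ j, ξ (ys j))) = 0 := by rw [e3, mul_zero]
      rw [← e1, ← sub_eq_zero, ← e2, hT]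
      simp only [Finset.mul_sum (a := μ x), Finset.mul_sum (a := μ x * ξ x ^ 2),
        Finset.mul_sum (a := 2 * μ x * ξ x)]
      rw [← Finset.sum_add_distrib, ← Finset.sum_sub_distrib]
      apply Finset.sum_congr rfl
      intro ys _
      by_cases hA : A x
      · simp only [hA, if_true]; ring
      · simp only [hA, if_false, hξ x hA]; ring
    have Rr : ∀ x : X, ∑ ys : Fin k → X, (μ x * ∏ j, μ (ys j)) *
        (h ((if A x then 1 else 0) + (Finset.univ.filter (fun j => A (ys j))).card)
          * (((if A x then 1 else 0) + (Finset.univ.filter (fun j => A (ys j))).card : ℕ) : ℝ))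
        = (μ x * (if A x then 1 else 0)) * T + μ x * (∑ ys : Fin k → X, (∏ j, μ (ys j)) *
          (h ((if A x then 1 else 0) + (Finset.univ.filter (fun j => A (ys j))).card) *
        ((Finset.univ.filter (fun j => A (ys j))).card : ℝ))) := by
      intro x
      rw [hT, Finset.mul_sum, Finset.mul_sum, ← Finset.sum_add_distrib]
      apply Finset.sum_congr rfl
      intro ys _
      by_cases hA : A x
      · simp only [hA, if_true]; push_cast; ring
      · simp only [hA, if_false]; push_cast; ring
    simp only [L, Rr]
    rw [Finset.sum_add_distrib, Finset.sum_add_distrib, ← Finset.sum_mul, ← Finset.sum_mul, h2,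
      mul_add]
    congr 1
    · ring
    · rw [Finset.mul_sum (a := v)]
      exact Finset.sum_congr rfl (fun x _ => by ring)

lemma aux_total {X : Type*} [Fintype X] (μ : X → ℝ) (hμ1 : ∑ x, μ x = 1) (k : ℕ) :
    ∑ ys : Fin k → X, ∏ j, μ (ys j) = 1 := by
  induction k with
  | zero => simp
  | succ k ih =>
    rw [aux_split 0]
    simp only [aux_prod, ← Finset.mul_sum, ih, mul_one, hμ1]

lemma aux_cond {X : Type*} [Fintype X] (μ : X → ℝ) (hμ0 : ∀ x, 0 ≤ μ x)
    (A B : X → Prop) (c : ℝ) (hc0 : 0 ≤ c) (hc1 : c ≤ 1)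
    (hc : ∑ x, (if A x ∧ B x then μ x else 0) = c * ∑ x, if A x then μ x else 0) (k : ℕ) :
    ∑ ys : Fin k → X, (∏ j, μ (ys j)) *
      ((if 0 < (Finset.univ.filter (fun j => A (ys j))).card then
        ((Finset.univ.filter (fun j => A (ys j) ∧ B (ys j))).card : ℝ) /
        ((Finset.univ.filter (fun j => A (ys j))).card : ℝ) else 0) - c) ^ 2 ≤
    ∑ ys : Fin k → X, (∏ j, μ (ys j)) *
      (1 / (1 + ((Finset.univ.filter (fun j => A (ys j))).card : ℝ))) := by
  set ξ : X → ℝ := fun x => (if A x ∧ B x then 1 else 0) - c * (if A x then 1 else 0) with hξd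
  have hξ : ∀ x, ¬ A x → ξ x = 0 := by intro x hx; simp [hξd, hx]
  have h1 : ∑ x, μ x * ξ x = 0 := by
    rw [← sub_eq_zero] at hc
    rw [← hc, Finset.mul_sum, ← Finset.sum_sub_distrib]
    refine Finset.sum_congr rfl fun x _ => ?_
    simp only [hξd]; split_ifs <;> ring
  have h2 : ∑ x, μ x * ξ x ^ 2 = (c * (1 - c)) * ∑ x, μ x * (if A x then 1 else 0) := by
    have : ∑ x, μ x * ξ x ^ 2 - (c * (1 - c)) * ∑ x, μ x * (if A x then 1 else 0)
        = (1 - 2 * c) * ∑ x, μ x * ξ x := by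
      rw [Finset.mul_sum, Finset.mul_sum, ← Finset.sum_sub_distrib]
      refine Finset.sum_congr rfl fun x _ => ?_
      simp only [hξd]
      by_cases hA : A x <;> by_cases hB : B x <;> simp [hA, hB] <;> ring
    rw [h1, mul_zero] at this
    linarith
  have hsum : ∀ ys : Fin k → X, ∑ j, ξ (ys j) =
      ((Finset.univ.filter (fun j => A (ys j) ∧ B (ys j))).card : ℝ) -
        c * ((Finset.univ.filter (fun j => A (ys j))).card : ℝ) := by
    intro ys
    simp only [hξd, Finset.sum_sub_distrib, ← Finset.mul_sum, Finset.card_filter]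
    push_cast
    rfl
  have key := aux_second μ A ξ (c * (1 - c)) hξ h1 h2 k
    (fun a => if a = 0 then 0 else 1 / (a : ℝ) ^ 2)
  have e1 : ∀ ys : Fin k → X, (∏ j, μ (ys j)) *
      ((if 0 < (Finset.univ.filter (fun j => A (ys j))).card then
        ((Finset.univ.filter (fun j => A (ys j) ∧ B (ys j))).card : ℝ) /
        ((Finset.univ.filter (fun j => A (ys j))).card : ℝ) else 0) - c) ^ 2 =
      (∏ j, μ (ys j)) * ((fun a : ℕ => if a = 0 then 0 else 1 / (a : ℝ) ^ 2)
          (Finset.univ.filter (fun j => A (ys j))).card * (∑ j, ξ (ys j)) ^ 2) +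
      (∏ j, μ (ys j)) * (if (Finset.univ.filter (fun j => A (ys j))).card = 0 then c ^ 2 else 0) := by
    intro ys
    rw [hsum, ← mul_add]
    congr 1
    generalize (Finset.univ.filter (fun j => A (ys j) ∧ B (ys j))).card = b
    generalize (Finset.univ.filter (fun j => A (ys j))).card = a
    rcases Nat.eq_zero_or_pos a with h | h
    · simp [h]
    · have : (a : ℝ) ≠ 0 := by positivity
      simp only [h, h.ne', if_true, if_false]
      field_simp
      ring
  simp only [e1]
  rw [Finset.sum_add_distrib, key, Finset.mul_sum, ← Finset.sum_add_distrib]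
  refine Finset.sum_le_sum fun ys _ => ?_
  have hP : 0 ≤ ∏ j, μ (ys j) := Finset.prod_nonneg fun j _ => hμ0 _
  generalize (∏ j, μ (ys j)) = P at *
  generalize (Finset.univ.filter (fun j => A (ys j))).card = a
  have : (c * (1 - c)) * ((if a = 0 then 0 else 1 / (a : ℝ) ^ 2) * (a : ℝ)) +
      (if a = 0 then c ^ 2 else 0) ≤ 1 / (1 + (a : ℝ)) := by
    rcases Nat.eq_zero_or_pos a with h | h
    · simp [h]; rw [abs_le]; constructor <;> linarith
    · have h' : (1 : ℝ) ≤ a := by exact_mod_cast h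
      simp only [h.ne', if_false, add_zero]
      have : 1 / (a : ℝ) ^ 2 * a = 1 / a := by field_simp
      rw [this, mul_one_div, div_le_div_iff₀ (by linarith) (by linarith)]
      have : c * (1 - c) ≤ 1 / 4 := by nlinarith [sq_nonneg (c - 1 / 2)]
      nlinarith
  calc _ = P * ((c * (1 - c)) * ((if a = 0 then 0 else 1 / (a : ℝ) ^ 2) * (a : ℝ)) +
      (if a = 0 then c ^ 2 else 0)) := by ring
    _ ≤ _ := mul_le_mul_of_nonneg_left this hP

lemma aux_count {X E : Type*} [Fintype X] [Fintype E] (e : X → E)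
    (R : X → E → Prop) (hR : ∀ x, R x (e x)) (n : ℕ) (xs : Fin n → X) :
    ∑ i, (1 / ((Finset.univ.filter (fun j => R (xs j) (e (xs i)))).card : ℝ)) ≤
      ((Finset.univ.image e).card : ℝ) := by
  rw [← Finset.sum_fiberwise_of_maps_to (t := Finset.univ.image e) (g := fun i => e (xs i))
    (fun i _ => Finset.mem_image_of_mem _ (Finset.mem_univ _))]
  rw [Finset.card_eq_sum_ones]
  push_cast
  refine Finset.sum_le_sum fun π _ => ?_
  rw [Finset.sum_congr rfl (g := fun _ =>
    1 / ((Finset.univ.filter (fun j => R (xs j) π)).card : ℝ))]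
  · rw [Finset.sum_const, nsmul_eq_mul, mul_one_div]
    apply div_le_one_of_le₀ _ (by positivity)
    norm_cast
    apply Finset.card_le_card
    intro i hi
    simp only [Finset.mem_filter, Finset.mem_univ, true_and] at hi ⊢
    rw [← hi]; exact hR _
  · intro i hi
    rw [(Finset.mem_filter.mp hi).2]


/-- Sample-complexity bound: for `ε ∈ (0,1)`, if the sample size satisfies
`n ≥ K · (12/ε) · log(3/ε)` where `K` is the number of distinct explanations,
then the mean-squared error of the faithfulness estimator is at most `ε`. -/
theorem estimator_sample_complexity {X Y E : Type*}
    [Fintype X] [Fintype Y] [Fintype E] [Nonempty X] [Nonempty Y] [Nonempty E]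
    (μ : X → ℝ) (hμ0 : ∀ x, 0 ≤ μ x) (hμ1 : ∑ x, μ x = 1)
    (f : X → Y) (e : X → E)
    (R : X → E → Prop) (hR : ∀ x, R x (e x))
    -- q(π) = μ{x : R(x,π)}
    (q : E → ℝ) (hq : ∀ π, q π = ∑ x, if R x π then μ x else 0)
    -- for q(π) > 0, q(y|π) = μ{x : R(x,π) ∧ f(x) = y} / q(π)
    (qc : Y → E → ℝ)
    (hqc : ∀ y π, 0 < q π →
      qc y π = (∑ x, if R x π ∧ f x = y then μ x else 0) / q π)
    -- true faithfulness measure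
    (m : ℝ) (hm : m = ∑ x, μ x * qc (f x) (e x))
    (ε : ℝ) (hε0 : 0 < ε) (hε1 : ε < 1)
    -- K = number of distinct explanations, K = |range(e)|
    (K : ℕ) (hK : K = (Finset.univ.image e).card)
    (n : ℕ)
    (hn : (K : ℝ) * (12 / ε) * Real.log (3 / ε) ≤ (n : ℝ))
    -- the estimator M̂ on a sample (x_1,…,x_n)
    (Mhat : (Fin n → X) → ℝ)
    (hM : ∀ xs, Mhat xs = (1 / (n : ℝ)) * ∑ i,
      if 1 < (Finset.univ.filter (fun j => R (xs j) (e (xs i)))).card then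
        (((Finset.univ.filter
            (fun j => R (xs j) (e (xs i)) ∧ f (xs j) = f (xs i))).card : ℝ) - 1) /
        (((Finset.univ.filter (fun j => R (xs j) (e (xs i)))).card : ℝ) - 1)
      else 0) :
    ∑ xs : Fin n → X, (∏ i, μ (xs i)) * (Mhat xs - m) ^ 2 ≤ ε := by
  have hKpos : (1 : ℝ) ≤ K := by
    rw [hK]; norm_cast
    exact Finset.card_pos.mpr (Finset.univ_nonempty.image e)
  have hlog : 1 ≤ Real.log (3 / ε) := by
    rw [Real.le_log_iff_exp_le (by positivity)]
    have h3 : (3 : ℝ) ≤ 3 / ε := by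
      rw [le_div_iff₀ hε0]; linarith
    linarith [Real.exp_one_lt_d9]
  have hn12 : (K : ℝ) * (12 / ε) ≤ n :=
    le_trans (le_mul_of_one_le_right (by positivity) hlog) hn
  have hn0 : (0 : ℝ) < n := lt_of_lt_of_le (by positivity) hn12
  obtain ⟨k, rfl⟩ : ∃ k, n = k + 1 :=
    Nat.exists_eq_succ_of_ne_zero (by rintro rfl; simp at hn0)
  set g : X → ℝ := fun x => qc (f x) (e x) with hg
  have hP : ∀ xs : Fin (k+1) → X, 0 ≤ ∏ j, μ (xs j) :=
    fun xs => Finset.prod_nonneg fun j _ => hμ0 _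
  -- properties of g
  have hqpos : ∀ x, 0 < μ x → 0 < q (e x) := by
    intro x hx
    rw [hq]
    refine Finset.sum_pos' (fun z _ => ?_) ⟨x, Finset.mem_univ _, ?_⟩
    · split_ifs; exacts [hμ0 z, le_rfl]
    · rw [if_pos (hR x)]; exact hx
  have hg0 : ∀ x, 0 < μ x → 0 ≤ g x ∧ g x ≤ 1 ∧
      ∑ z, (if R z (e x) ∧ f z = f x then μ z else 0) =
        g x * ∑ z, if R z (e x) then μ z else 0 := by
    intro x hx
    have hp := hqpos x hx
    simp only [hg]
    rw [hqc _ _ hp]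
    refine ⟨div_nonneg (Finset.sum_nonneg fun z _ => ?_) hp.le, ?_, ?_⟩
    · split_ifs; exacts [hμ0 z, le_rfl]
    · rw [div_le_one hp, hq]
      refine Finset.sum_le_sum fun z _ => ?_
      by_cases h1 : R z (e x) <;> by_cases h2 : f z = f x <;> simp [h1, h2, hμ0 z]
    · rw [← hq, div_mul_cancel₀ _ hp.ne']
  -- variance part
  have hvar : ∑ xs : Fin (k+1) → X, (∏ j, μ (xs j)) * (∑ j, (g (xs j) - m)) ^ 2
      ≤ ((k + 1 : ℕ) : ℝ) := by
    have h1 : ∑ x, μ x * (g x - m) = 0 := by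
      simp only [mul_sub, Finset.sum_sub_distrib, ← Finset.sum_mul, hμ1, one_mul]
      rw [hm, sub_self]
    have key := aux_second μ (fun _ => True) (fun x => g x - m)
      (∑ x, μ x * (g x - m) ^ 2) (by simp) h1 (by simp [hμ1]) (k+1) (fun _ => 1)
    have hv : ∑ x, μ x * (g x - m) ^ 2 ≤ 1 := by
      have : ∑ x, μ x * (g x - m) ^ 2 + m ^ 2 = ∑ x, μ x * g x ^ 2 := by
        have : ∑ x, μ x * (g x - m) ^ 2 = ∑ x, μ x * g x ^ 2 - 2 * m * ∑ x, μ x * (g x - m)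
            - m ^ 2 * ∑ x, μ x := by
          simp only [Finset.mul_sum, ← Finset.sum_sub_distrib]
          exact Finset.sum_congr rfl fun x _ => by ring
        rw [this, h1, hμ1]; ring
      have h' : ∑ x, μ x * g x ^ 2 ≤ ∑ x, μ x := by
        refine Finset.sum_le_sum fun x _ => ?_
        rcases (hμ0 x).eq_or_lt with h | h
        · simp [← h]
        · obtain ⟨a, b, _⟩ := hg0 x h
          exact mul_le_of_le_one_right h.le (pow_le_one₀ a b)
      nlinarith [sq_nonneg m]
    simp only [one_mul, Finset.filter_true, Finset.card_univ, Fintype.card_fin,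
      ← Finset.sum_mul, aux_total μ hμ1] at key
    rw [key]
    exact mul_le_of_le_one_left hn0.le hv
  -- conditional part
  set Z : (Fin (k+1) → X) → Fin (k+1) → ℝ := fun xs i =>
      if 1 < (Finset.univ.filter (fun j => R (xs j) (e (xs i)))).card then
        (((Finset.univ.filter
            (fun j => R (xs j) (e (xs i)) ∧ f (xs j) = f (xs i))).card : ℝ) - 1) /
        (((Finset.univ.filter (fun j => R (xs j) (e (xs i)))).card : ℝ) - 1)
      else 0 with hZ
  have hcond : ∀ i : Fin (k+1), ∑ xs : Fin (k+1) → X, (∏ j, μ (xs j)) * (Z xs i - g (xs i)) ^ 2 ≤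
      ∑ xs : Fin (k+1) → X, (∏ j, μ (xs j)) *
        (1 / ((Finset.univ.filter (fun j => R (xs j) (e (xs i)))).card : ℝ)) := by
    intro i
    rw [aux_split i, aux_split i]
    refine Finset.sum_le_sum fun x _ => ?_
    have hc2 : ∀ ys : Fin k → X, (Finset.univ.filter (fun j =>
        R ((i.insertNth x ys : Fin (k+1) → X) j) (e x) ∧
          f ((i.insertNth x ys : Fin (k+1) → X) j) = f x)).card =
        1 + (Finset.univ.filter (fun j => R (ys j) (e x) ∧ f (ys j) = f x)).card := by
      intro ys
      have := aux_card i (fun z => R z (e x) ∧ f z = f x) x ys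
      rw [if_pos ⟨hR x, rfl⟩] at this
      convert this
    simp only [hZ, Fin.insertNth_apply_same]
    simp only [aux_prod, aux_card i (fun z => R z (e x)),
      hc2, hR x, if_true, mul_assoc,
      ← Finset.mul_sum]
    rcases (hμ0 x).eq_or_lt with h | h
    · simp [← h]
    refine mul_le_mul_of_nonneg_left ?_ h.le
    obtain ⟨a, b, c⟩ := hg0 x h
    have := aux_cond μ hμ0 (fun z => R z (e x)) (fun z => f z = f x) (g x) a b c k
    simpa using this
  have hA : ∑ xs : Fin (k+1) → X, (∏ j, μ (xs j)) * ∑ i, (Z xs i - g (xs i)) ^ 2 ≤ K := by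
    simp only [Finset.mul_sum]
    rw [Finset.sum_comm]
    refine (Finset.sum_le_sum fun i _ => hcond i).trans ?_
    rw [Finset.sum_comm]
    simp only [← Finset.mul_sum]
    refine (Finset.sum_le_sum fun xs _ =>
      mul_le_mul_of_nonneg_left (aux_count e R hR _ xs) (hP xs)).trans ?_
    rw [← Finset.sum_mul, aux_total μ hμ1, one_mul, hK]
  set N : ℝ := ((k + 1 : ℕ) : ℝ) with hN
  have hpt : ∀ xs : Fin (k+1) → X, (∏ j, μ (xs j)) * (Mhat xs - m) ^ 2 ≤
      (2 / N) * ((∏ j, μ (xs j)) * ∑ i, (Z xs i - g (xs i)) ^ 2) +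
      (2 / N ^ 2) * ((∏ j, μ (xs j)) * (∑ j, (g (xs j) - m)) ^ 2) := by
    intro xs
    have e1 : Mhat xs - m = (1 / N) * (∑ i, (Z xs i - g (xs i)) + ∑ j, (g (xs j) - m)) := by
      rw [← Finset.sum_add_distrib]
      simp only [sub_add_sub_cancel]
      rw [Finset.sum_sub_distrib, Finset.sum_const, Finset.card_univ, Fintype.card_fin,
        nsmul_eq_mul, ← hN, hM xs, mul_sub, ← mul_assoc, one_div, inv_mul_cancel₀ hn0.ne', one_mul]
    have cs : (∑ i, (Z xs i - g (xs i))) ^ 2 ≤ N * ∑ i, (Z xs i - g (xs i)) ^ 2 := by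
      have := sq_sum_le_card_mul_sum_sq (s := Finset.univ) (f := fun i => Z xs i - g (xs i))
      simpa only [Finset.card_univ, Fintype.card_fin] using this
    rw [e1]
    generalize (∑ i, (Z xs i - g (xs i))) = S at *
    generalize (∑ i, (Z xs i - g (xs i)) ^ 2) = Q at *
    generalize ∑ j, (g (xs j) - m) = T
    have h0 := hP xs
    generalize (∏ j, μ (xs j)) = P at *
    have : (1 / N * (S + T)) ^ 2 ≤ 2 / N * Q + 2 / N ^ 2 * T ^ 2 := by
      have : 2 / N * Q = 2 / N ^ 2 * (N * Q) := by field_simp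
      rw [this, ← mul_add, mul_pow, one_div, inv_pow, div_mul_eq_mul_div, inv_mul_eq_div]
      gcongr
      nlinarith [sq_nonneg (S - T)]
    calc _ ≤ P * (2 / N * Q + 2 / N ^ 2 * T ^ 2) := mul_le_mul_of_nonneg_left this h0
      _ = _ := by ring
  refine (Finset.sum_le_sum fun xs _ => hpt xs).trans ?_
  rw [Finset.sum_add_distrib, ← Finset.mul_sum, ← Finset.mul_sum]
  have b1 : 2 / N * ∑ xs : Fin (k+1) → X, (∏ j, μ (xs j)) * ∑ i, (Z xs i - g (xs i)) ^ 2
      ≤ 2 / N * K := mul_le_mul_of_nonneg_left hA (by positivity)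
  have b2 : 2 / N ^ 2 * ∑ xs : Fin (k+1) → X, (∏ j, μ (xs j)) * (∑ j, (g (xs j) - m)) ^ 2
      ≤ 2 / N ^ 2 * N := mul_le_mul_of_nonneg_left hvar (by positivity)
  have b3 : 2 / N * K + 2 / N ^ 2 * N ≤ ε := by
    have : 2 / N * K + 2 / N ^ 2 * N = (2 * K + 2) / N := by field_simp
    rw [this, div_le_iff₀ hn0]
    have : (K : ℝ) * 12 ≤ ε * N := by
      have := mul_le_mul_of_nonneg_left hn12 hε0.le
      calc (K : ℝ) * 12 = ε * (K * (12 / ε)) := by field_simp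
        _ ≤ _ := this
    linarith
  linarith
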